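/- Let ℓ ≥ 3 be an odd integer and let m = ⌊√ℓ + 7/2⌋. For every integer k ≥ 1 and n = (ℓ+1)^k, there exists a completely balanced edge-coloring of the complete graph K_n with ℓ colors that contains no rainbow copy of K_m. -/

import Mathlib

/-- A set `S` of vertices is rainbow under an edge-coloring `c` if all edges with both
endpoints in `S` receive pairwise distinct colors. -/
def IsRainbow {V C : Type*} (c : V → V → C) (S : Finset V) : Prop :=
  ∀ a ∈ S, ∀ b ∈ S, ∀ a' ∈ S, ∀ b' ∈ S,
    a ≠ b → a' ≠ b' → c a b = c a' b' → (a = a' ∧ b = b') ∨ (a = b' ∧ b = a')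

/-- The coloring `c` contains a rainbow copy of `K_q`. -/
def HasRainbowClique {V C : Type*} (c : V → V → C) (q : ℕ) : Prop :=
  ∃ S : Finset V, S.card = q ∧ IsRainbow c S

/-- An edge-coloring of `K_n` with `l` colors is completely balanced if every vertex
is incident to exactly `(n-1)/l` edges of each color; in particular `l` divides `n-1`. -/
def IsCompletelyBalanced {n l : ℕ} (c : Fin n → Fin n → Fin l) : Prop :=
  ∃ d : ℕ, n - 1 = l * d ∧
    ∀ v : Fin n, ∀ k : Fin l,
      (Finset.univ.filter fun u => u ≠ v ∧ c v u = k).card = d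

open Finset in
/-- A coloring that is symmetric, has `d` edges of each color at each vertex, and whose rainbow
sets all have fewer than `m` vertices. -/
def IsBalancedWithoutRainbow {V C : Type*} [Fintype V] [DecidableEq V] [DecidableEq C]
    (c : V → V → C) (d m : ℕ) : Prop :=
  (∀ a b, c a b = c b a) ∧ (∀ v k, #{u | u ≠ v ∧ c v u = k} = d) ∧
    ∀ S : Finset V, IsRainbow c S → #S < m

theorem IsRainbow.image {V W C C' : Type*} [DecidableEq W] {c : V → V → C} {b : W → W → C'}
    {S : Finset V} (hS : IsRainbow c S) (f : V → W)
    (hf : ∀ x ∈ S, ∀ y ∈ S, ∀ x' ∈ S, ∀ y' ∈ S, f x ≠ f y → f x' ≠ f y' →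
      b (f x) (f y) = b (f x') (f y') → c x y = c x' y') :
    IsRainbow b (S.image f) := by
  intro a ha a₁ ha₁ a' ha' a₁' ha₁' hne hne' h
  simp only [Finset.mem_image] at ha ha₁ ha' ha₁'
  obtain ⟨x, hx, rfl⟩ := ha
  obtain ⟨y, hy, rfl⟩ := ha₁
  obtain ⟨x', hx', rfl⟩ := ha'
  obtain ⟨y', hy', rfl⟩ := ha₁'
  rcases hS x hx y hy x' hx' y' hy' (ne_of_apply_ne f hne) (ne_of_apply_ne f hne')
    (hf x hx y hy x' hx' y' hy' hne hne' h) with ⟨rfl, rfl⟩ | ⟨rfl, rfl⟩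
  · exact Or.inl ⟨rfl, rfl⟩
  · exact Or.inr ⟨rfl, rfl⟩

open Finset in
/-- The coloring on blocks indexed by `W`: `c` inside every block, `b` between blocks. -/
theorem IsBalancedWithoutRainbow.prod {V W C : Type*} [Fintype V] [DecidableEq V] [Fintype W]
    [DecidableEq W] [DecidableEq C] {c : V → V → C} {b : W → W → C} {d m : ℕ}
    (hc : IsBalancedWithoutRainbow c d m) (hb : IsBalancedWithoutRainbow b 1 m) :
    IsBalancedWithoutRainbow
      (fun p q : V × W => if p.2 = q.2 then c p.1 q.1 else b p.2 q.2)
      (d + Fintype.card V) m := by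
  obtain ⟨hcs, hcd, hcr⟩ := hc
  obtain ⟨hbs, hbd, hbr⟩ := hb
  refine ⟨fun p q => ?_, fun ⟨v, w⟩ t => ?_, fun S hS => ?_⟩
  · by_cases h : p.2 = q.2
    · simp [h, hcs p.1]
    · simp [h, Ne.symm h, hbs p.2]
  · have hsplit : (univ.filter fun u : V × W => u ≠ (v, w) ∧
        (if w = u.2 then c v u.1 else b w u.2) = t) =
        (univ.filter fun u => u ≠ v ∧ c v u = t) ×ˢ {w} ∪
          univ ×ˢ (univ.filter fun u => u ≠ w ∧ b w u = t) := by
      ext ⟨x, y⟩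
      by_cases h : w = y
      · subst h; simp
      · simp [h, Ne.symm h]
    have hdisj : Disjoint ((univ.filter fun u => u ≠ v ∧ c v u = t) ×ˢ ({w} : Finset W))
        (univ ×ˢ (univ.filter fun u => u ≠ w ∧ b w u = t)) := by
      rw [disjoint_left]
      rintro ⟨x, y⟩ h h'
      simp_all
    change #(univ.filter fun u : V × W => u ≠ (v, w) ∧
        (if w = u.2 then c v u.1 else b w u.2) = t) = _
    rw [hsplit, card_union_of_disjoint hdisj, card_product, card_product, hcd, hbd]
    simp
  · by_cases hsame : ∀ p ∈ S, ∀ q ∈ S, p.2 = q.2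
    · have hinj : Set.InjOn Prod.fst (S : Set (V × W)) := fun p hp q hq h =>
        Prod.ext h (hsame p hp q hq)
      rw [← card_image_of_injOn hinj]
      refine hcr _ (hS.image _ fun x hx y hy x' hx' y' hy' _ _ h => ?_)
      simpa [hsame x hx y hy, hsame x' hx' y' hy'] using h
    · have hinj : Set.InjOn Prod.snd (S : Set (V × W)) := by
        intro p hp q hq h
        by_contra hpq
        obtain ⟨r, hr, hrp⟩ : ∃ r ∈ S, p.2 ≠ r.2 := by
          by_contra! hall
          exact hsame fun x hx y hy => (hall x hx).symm.trans (hall y hy)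
        have hpr : p ≠ r := ne_of_apply_ne _ hrp
        have hqr : q ≠ r := ne_of_apply_ne Prod.snd (h ▸ hrp)
        rcases hS p hp r hr q hq r hr hpr hqr (by simp [← h, hrp]) with h' | h'
        · exact hpq h'.1
        · exact hpr h'.1
      rw [← card_image_of_injOn hinj]
      refine hbr _ (hS.image _ fun x hx y hy x' hx' y' hy' hne hne' h => ?_)
      simpa [hne, hne'] using h

theorem IsBalancedWithoutRainbow.comp_equiv {V W C C' : Type*} [Fintype V] [DecidableEq V]
    [Fintype W] [DecidableEq W] [DecidableEq C] [DecidableEq C'] {c : V → V → C} {d m : ℕ}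
    (hc : IsBalancedWithoutRainbow c d m) (e : W ≃ V) (f : C ≃ C') :
    IsBalancedWithoutRainbow (fun x y => f (c (e x) (e y))) d m := by
  obtain ⟨hcs, hcd, hcr⟩ := hc
  refine ⟨fun _ _ => congrArg f (hcs _ _), fun v t => ?_, fun S hS => ?_⟩
  · rw [← hcd (e v) (f.symm t)]
    refine Finset.card_equiv e fun x => ?_
    simp [Equiv.eq_symm_apply]
  · rw [← Finset.card_image_of_injective S e.injective]
    exact hcr _ (hS.image e fun x _ y _ x' _ y' _ _ _ h => by rw [h])

open Finset in
/-- In a weak Sidon set, differences `x - y` for which `2y - x` is not in the set are distinct. -/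
theorem card_offDiag_filter_le_of_weakSidon {G : Type*} [AddCommGroup G] [Fintype G]
    [DecidableEq G] {T : Finset G}
    (hT : ∀ a ∈ T, ∀ b ∈ T, ∀ a' ∈ T, ∀ b' ∈ T, a ≠ b → a' ≠ b' → a + b = a' + b' →
      (a = a' ∧ b = b') ∨ (a = b' ∧ b = a')) :
    #{p ∈ T.offDiag | p.2 + p.2 - p.1 ∉ T} ≤ Fintype.card G := by
  rw [← card_univ]
  refine card_le_card_of_injOn (fun p => p.1 - p.2) (fun _ _ => mem_coe.2 (mem_univ _)) ?_
  rintro ⟨x, y⟩ hp ⟨z, w⟩ hq h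
  simp only [coe_filter, mem_offDiag, Set.mem_ofPred_eq] at hp hq h
  obtain ⟨⟨hx, hy, hxy⟩, hbad⟩ := hp
  obtain ⟨⟨hz, hw, hzw⟩, hbad'⟩ := hq
  have hsum : x + w = z + y := by
    rw [sub_eq_sub_iff_add_eq_add] at h; exact h
  by_cases hxw : x = w
  · subst hxw
    refine absurd ?_ hbad'
    convert hy using 1
    rw [hsum]; abel
  by_cases hzy : z = y
  · subst hzy
    refine absurd ?_ hbad
    convert hw using 1
    rw [← hsum]; abel
  rcases hT x hx w hw z hz y hy hxw hzy hsum with ⟨rfl, rfl⟩ | ⟨rfl, rfl⟩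
  · rfl
  · exact absurd rfl hxy

open Finset in
/-- Each element of a weak Sidon set is the midpoint of at most two ordered pairs. -/
theorem card_offDiag_filter_le_two_mul_of_weakSidon {G : Type*} [AddCommGroup G]
    [DecidableEq G] (hG : ∀ x y : G, x + x = y + y → x = y) {T : Finset G}
    (hT : ∀ a ∈ T, ∀ b ∈ T, ∀ a' ∈ T, ∀ b' ∈ T, a ≠ b → a' ≠ b' → a + b = a' + b' →
      (a = a' ∧ b = b') ∨ (a = b' ∧ b = a')) :
    #{p ∈ T.offDiag | p.2 + p.2 - p.1 ∈ T} ≤ 2 * #T := by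
  refine card_le_mul_card_image_of_maps_to (f := Prod.snd) ?_ 2 fun y _ => ?_
  · simp only [mem_filter, mem_offDiag]
    exact fun p hp => hp.1.2.1
  have hne {x : G} (hxy : x ≠ y) : x ≠ y + y - x := fun h =>
    hxy (hG _ _ (eq_sub_iff_add_eq.1 h))
  rcases eq_empty_or_nonempty {p ∈ {p ∈ T.offDiag | p.2 + p.2 - p.1 ∈ T} | p.2 = y}
    with he | ⟨⟨x, y'⟩, hx⟩
  · simp [he]
  simp only [mem_filter, mem_offDiag] at hx
  obtain ⟨⟨⟨hx, -, hxy⟩, hmem⟩, rfl⟩ := hx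
  refine (card_le_card (t := {(x, y'), (y' + y' - x, y')}) ?_).trans card_le_two
  rintro ⟨z, y⟩ hz
  simp only [mem_filter, mem_offDiag] at hz
  obtain ⟨⟨⟨hz, -, hzy⟩, hmem'⟩, rfl⟩ := hz
  rcases hT z hz _ hmem' x hx _ hmem (hne hzy) (hne hxy) (by abel) with h | h <;> simp [h.1]

/-- The one-factorization of the complete graph on `G ∪ {∞}`. -/
def sumColoring (G : Type*) [AddCommGroup G] : Option G → Option G → G
  | some x, some y => x + y
  | some x, none => x + x
  | none, some y => y + y
  | none, none => 0

open Finset in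
theorem sumColoring_isBalancedWithoutRainbow {G : Type*} [AddCommGroup G] [Fintype G]
    [DecidableEq G] (hG : Function.Bijective fun x : G => x + x)
    (hcard : 3 ≤ Fintype.card G) :
    IsBalancedWithoutRainbow (sumColoring G) 1
      ⌊Real.sqrt (Fintype.card G) + 7 / 2⌋₊ := by
  refine ⟨?_, ?_, fun S hS => ?_⟩
  · rintro (_ | x) (_ | y) <;> simp [sumColoring, add_comm]
  · rintro (_ | x) t
    · obtain ⟨y, rfl⟩ := hG.2 t
      refine card_eq_one.2 ⟨some y, ?_⟩
      ext (_ | z) <;> simp only [mem_filter, mem_univ, true_and, mem_singleton]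
      · simp
      · simpa [sumColoring] using (hG.1.eq_iff (a := z) (b := y))
    · by_cases hx : x + x = t
      · refine card_eq_one.2 ⟨none, ?_⟩
        ext (_ | z) <;> simp only [mem_filter, mem_univ, true_and, mem_singleton]
        · simp [sumColoring, hx]
        · simp [sumColoring, ← hx]
      · refine card_eq_one.2 ⟨some (t - x), ?_⟩
        ext (_ | z) <;> simp only [mem_filter, mem_univ, true_and, mem_singleton]
        · simp [sumColoring, hx]
        · simp only [sumColoring, ne_eq, Option.some.injEq, eq_sub_iff_add_eq, add_comm z x]
          constructor
          · exact And.right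
          · rintro h
            exact ⟨fun hz => hx (hz ▸ h), h⟩
  · set T := S.eraseNone with hTdef
    have hT : ∀ a ∈ T, ∀ b ∈ T, ∀ a' ∈ T, ∀ b' ∈ T, a ≠ b → a' ≠ b' → a + b = a' + b' →
        (a = a' ∧ b = b') ∨ (a = b' ∧ b = a') := by
      intro a ha b hb a' ha' b' hb' hab hab' h
      rw [hTdef, mem_eraseNone] at ha hb ha' hb'
      simpa using hS _ ha _ hb _ ha' _ hb' (by simpa) (by simpa) h
    have hgood := card_offDiag_filter_le_of_weakSidon hT
    have hbad := card_offDiag_filter_le_two_mul_of_weakSidon (fun x y h => hG.1 h) hT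
    have hsplit := card_filter_add_card_filter_not (s := T.offDiag)
      (fun p => p.2 + p.2 - p.1 ∈ T)
    rw [offDiag_card] at hsplit
    have hsplit' : (#T : ℝ) * #T = #T + #{p ∈ T.offDiag | p.2 + p.2 - p.1 ∈ T}
        + #{p ∈ T.offDiag | p.2 + p.2 - p.1 ∉ T} := by
      have := Nat.le_mul_self #T
      exact_mod_cast (show #T * #T = #T + #{p ∈ T.offDiag | p.2 + p.2 - p.1 ∈ T}
        + #{p ∈ T.offDiag | p.2 + p.2 - p.1 ∉ T} by omega)
    have hgood' : (#{p ∈ T.offDiag | p.2 + p.2 - p.1 ∉ T} : ℝ) ≤ Fintype.card G := by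
      exact_mod_cast hgood
    have hbad' : (#{p ∈ T.offDiag | p.2 + p.2 - p.1 ∈ T} : ℝ) ≤ 2 * #T := by
      exact_mod_cast hbad
    have hsq := Real.sq_sqrt (Nat.cast_nonneg (α := ℝ) (Fintype.card G))
    have hsqrt : 1 ≤ Real.sqrt (Fintype.card G) :=
      Real.one_le_sqrt.2 (by exact_mod_cast (by omega : 1 ≤ Fintype.card G))
    suffices h : (#S : ℝ) ≤ Real.sqrt (Fintype.card G) + 5 / 2 by
      refine Nat.lt_of_succ_le (Nat.le_floor ?_)
      push_cast
      linarith
    by_cases hnone : none ∈ S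
    · have hempty : #{p ∈ T.offDiag | p.2 + p.2 - p.1 ∈ T} = 0 := by
        rw [card_eq_zero, filter_eq_empty_iff]
        rintro ⟨x, y⟩ hp hmem
        simp only [mem_offDiag] at hp hmem
        obtain ⟨hx, hy, hxy⟩ := hp
        rw [hTdef, mem_eraseNone] at hx hy hmem
        have hne : x ≠ y + y - x := fun h => hxy (hG.1 (eq_sub_iff_add_eq.1 h))
        simpa using hS _ hx _ hmem _ hy _ hnone (by simpa) (by simp)
          (show x + (y + y - x) = y + y by abel)
      rw [hempty] at hsplit'
      have hST : (#S : ℝ) = #T + 1 := by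
        have : #T = #S - 1 := card_eraseNone_of_mem hnone
        have := card_pos.2 ⟨_, hnone⟩
        exact_mod_cast (show #S = #T + 1 by omega)
      push_cast at hsplit'
      nlinarith
    · have hST : #S = #T := (card_eraseNone_of_not_mem hnone).symm
      rw [hST]
      nlinarith

open Finset in
theorem exists_isBalancedWithoutRainbow_pow {W C : Type} [Fintype W] [DecidableEq W]
    [DecidableEq C] [Inhabited C] {b : W → W → C} {l m : ℕ} (hm : 2 ≤ m)
    (hb : IsBalancedWithoutRainbow b 1 m) (hW : Fintype.card W = l + 1) (k : ℕ) :
    ∃ (V : Type) (_ : Fintype V) (_ : DecidableEq V) (c : V → V → C) (d : ℕ),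
      Fintype.card V = (l + 1) ^ k ∧ (l + 1) ^ k = l * d + 1 ∧
        IsBalancedWithoutRainbow c d m := by
  induction k with
  | zero =>
    refine ⟨Unit, inferInstance, inferInstance, fun _ _ => default, 0, by simp, by simp,
      by simp, by simp, fun S _ => (card_le_one_of_subsingleton S).trans_lt hm⟩
  | succ k ih =>
    obtain ⟨V, _, _, c, d, hV, hd, hc⟩ := ih
    refine ⟨V × W, inferInstance, inferInstance, _, _, ?_, ?_, hc.prod hb⟩
    · rw [Fintype.card_prod, hV, hW, pow_succ]
    · rw [hV, pow_succ, mul_add, mul_add, mul_one]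
      nth_rewrite 2 [hd]
      ring

theorem no_rainbow_clique_balanced_coloring_odd_ell
    (l : ℕ) (hl : 3 ≤ l) (hodd : Odd l) (k : ℕ) (hk : 1 ≤ k) :
    ∃ c : Fin ((l + 1) ^ k) → Fin ((l + 1) ^ k) → Fin l,
      (∀ a b, c a b = c b a) ∧ IsCompletelyBalanced c ∧
      ¬ HasRainbowClique c (⌊Real.sqrt l + 7 / 2⌋₊) := by
  have : NeZero l := ⟨by omega⟩
  have hinj : Function.Injective fun x : ZMod l => x + x := by
    have hu : IsUnit ((2 : ℕ) : ZMod l) :=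
      (ZMod.isUnit_iff_coprime 2 l).2 (Nat.coprime_two_left.2 hodd)
    intro x y h
    refine hu.mul_left_cancel ?_
    simpa [two_mul] using h
  have hb := sumColoring_isBalancedWithoutRainbow (Finite.injective_iff_bijective.1 hinj)
    (by rwa [ZMod.card])
  rw [ZMod.card] at hb
  have hm : 2 ≤ ⌊Real.sqrt l + 7 / 2⌋₊ := by
    refine Nat.le_floor ?_
    push_cast
    linarith [Real.sqrt_nonneg (l : ℝ)]
  obtain ⟨V, _, _, c, d, hV, hd, hc⟩ := exists_isBalancedWithoutRainbow_pow hm hb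
    (l := l) (by rw [Fintype.card_option, ZMod.card]) k
  obtain ⟨hs, hdeg, hr⟩ := hc.comp_equiv (Fintype.equivFinOfCardEq hV).symm
    (Fintype.equivFinOfCardEq (ZMod.card l))
  refine ⟨_, hs, ⟨d, by omega, fun v t => ?_⟩, ?_⟩
  · convert hdeg v t
  · rintro ⟨S, hcard, hS⟩
    exact (hr S hS).ne hcard
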